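/- arXiv:1905.10180 — 5 statements merged into one kernel-verified Lean document; each statement's English description precedes it below -/
import Mathlib

section
/- Let n ≥ 1 and t ≥ 2 be integers. If C is a t-signature code of length n, then C is a B_t code; that is, for any two multiplicity functions m₁, m₂ : C → ℕ with Σ_{c∈C} m₁(c) = Σ_{c∈C} m₂(c) = t and m₁ ≠ m₂, one has Σ_{c∈C} m₁(c)·c ≠ Σ_{c∈C} m₂(c)·c (sums taken in ℝ^n). -/
open Finset

/-- A binary code of length `n`: every coordinate of every codeword is 0 or 1. -/
def IsBinaryCode {n : ℕ} (C : Finset (Fin n → ℝ)) : Prop :=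
  ∀ c ∈ C, ∀ i, c i = 0 ∨ c i = 1

/-- `C` is a `t`-signature code. -/
def IsSignatureCode {n : ℕ} (t : ℕ) (C : Finset (Fin n → ℝ)) : Prop :=
  ∀ C₁ ⊆ C, ∀ C₂ ⊆ C, C₁ ≠ C₂ →
    1 ≤ C₁.card → C₁.card ≤ t → 1 ≤ C₂.card → C₂.card ≤ t →
    ∀ lam mu : (Fin n → ℝ) → ℝ,
      (∀ c ∈ C₁, 0 < lam c) → (∀ c ∈ C₂, 0 < mu c) →
      (∑ c ∈ C₁, lam c) = 1 → (∑ c ∈ C₂, mu c) = 1 →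
      (∑ c ∈ C₁, lam c • c) ≠ (∑ c ∈ C₂, mu c • c)

/-- In a `t`-signature code, two convex weightings with supports of size at most `t` and with
equal barycentres have the same support. -/
lemma IsSignatureCode.support_eq {n t : ℕ} {C : Finset (Fin n → ℝ)} (h : IsSignatureCode t C)
    {a b : (Fin n → ℝ) → ℝ} (ha : ∀ c ∈ C, 0 ≤ a c) (hb : ∀ c ∈ C, 0 ≤ b c)
    (ha1 : ∑ c ∈ C, a c = 1) (hb1 : ∑ c ∈ C, b c = 1)
    (hat : (C.filter (a · ≠ 0)).card ≤ t) (hbt : (C.filter (b · ≠ 0)).card ≤ t)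
    (hab : ∑ c ∈ C, a c • c = ∑ c ∈ C, b c • c) :
    C.filter (a · ≠ 0) = C.filter (b · ≠ 0) := by
  have sum_filter_one {f : (Fin n → ℝ) → ℝ} (hf : ∑ c ∈ C, f c = 1) :
      ∑ c ∈ C.filter (f · ≠ 0), f c = 1 := by rwa [sum_filter_ne_zero]
  have sum_filter_smul (f : (Fin n → ℝ) → ℝ) :
      ∑ c ∈ C.filter (f · ≠ 0), f c • c = ∑ c ∈ C, f c • c :=
    sum_filter_of_ne fun c _ hc h0 => hc (by rw [h0, zero_smul])
  have card_pos {f : (Fin n → ℝ) → ℝ} (hf : ∑ c ∈ C, f c = 1) :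
      1 ≤ (C.filter (f · ≠ 0)).card :=
    Finset.card_pos.2 (nonempty_of_sum_ne_zero ((sum_filter_one hf).trans_ne one_ne_zero))
  have pos {f : (Fin n → ℝ) → ℝ} (hf : ∀ c ∈ C, 0 ≤ f c) :
      ∀ c ∈ C.filter (f · ≠ 0), 0 < f c := fun c hc =>
    (hf c (mem_filter.1 hc).1).lt_of_ne' (mem_filter.1 hc).2
  by_contra hne
  refine h _ (filter_subset _ _) _ (filter_subset _ _) hne (card_pos ha1) hat (card_pos hb1) hbt
    a b (pos ha) (pos hb) (sum_filter_one ha1) (sum_filter_one hb1) ?_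
  rw [sum_filter_smul, sum_filter_smul, hab]

/-- In a `t`-signature code, two convex weightings with supports of size at most `t` and with
equal barycentres coincide. -/
lemma IsSignatureCode.eq_of_sum_smul_eq {n t : ℕ} {C : Finset (Fin n → ℝ)}
    (h : IsSignatureCode t C) {a b : (Fin n → ℝ) → ℝ}
    (ha : ∀ c ∈ C, 0 ≤ a c) (hb : ∀ c ∈ C, 0 ≤ b c)
    (ha1 : ∑ c ∈ C, a c = 1) (hb1 : ∑ c ∈ C, b c = 1)
    (hat : (C.filter (a · ≠ 0)).card ≤ t) (hbt : (C.filter (b · ≠ 0)).card ≤ t)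
    (hab : ∑ c ∈ C, a c • c = ∑ c ∈ C, b c • c) :
    ∀ c ∈ C, a c = b c := by
  by_contra! hne
  obtain ⟨d, hd, hdne⟩ := hne
  have hsupp := h.support_eq ha hb ha1 hb1 hat hbt hab
  obtain ⟨e, he, hlt⟩ : ∃ e ∈ C, a e < b e := by
    by_contra! hle
    exact hdne (((sum_eq_sum_iff_of_le hle).1 (hb1.trans ha1.symm)) d hd).symm
  have heS : e ∈ C.filter (b · ≠ 0) := mem_filter.2 ⟨he, ((ha e he).trans_lt hlt).ne'⟩
  obtain ⟨m, hm, hmin⟩ := exists_min_image (C.filter (b · ≠ 0)) (fun c => a c / b c) ⟨e, heS⟩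
  obtain ⟨hmC, hm0⟩ := mem_filter.1 hm
  -- Push `b` through `a` until the weight at `m` vanishes, which shrinks the support.
  set r := a m / b m with hr
  have hr1 : r < 1 := (hmin e heS).trans_lt ((div_lt_one ((ha e he).trans_lt hlt)).2 hlt)
  have hr1' : 1 - r ≠ 0 := (sub_pos.2 hr1).ne'
  let w : (Fin n → ℝ) → ℝ := fun c => (1 - r)⁻¹ * (a c - r * b c)
  have hw : ∀ c ∈ C, 0 ≤ w c := by
    intro c hc
    refine mul_nonneg (inv_nonneg.2 (sub_pos.2 hr1).le) (sub_nonneg.2 ?_)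
    by_cases hc0 : b c = 0
    · simpa [hc0] using ha c hc
    · exact (le_div_iff₀ ((hb c hc).lt_of_ne' hc0)).1 (hmin c (mem_filter.2 ⟨hc, hc0⟩))
  have hw1 : ∑ c ∈ C, w c = 1 := by
    simp only [w]
    rw [← mul_sum, sum_sub_distrib, ← mul_sum, ha1, hb1, mul_one, inv_mul_cancel₀ hr1']
  have hwsub : C.filter (w · ≠ 0) ⊆ C.filter (b · ≠ 0) := by
    intro c hc
    obtain ⟨hcC, hwc⟩ := mem_filter.1 hc
    refine mem_filter.2 ⟨hcC, fun hbc => hwc ?_⟩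
    have hac : a c = 0 := by
      by_contra hac
      have : c ∈ C.filter (b · ≠ 0) := hsupp ▸ mem_filter.2 ⟨hcC, hac⟩
      exact (mem_filter.1 this).2 hbc
    simp [w, hac, hbc]
  have hwb : ∑ c ∈ C, w c • c = ∑ c ∈ C, b c • c := by
    simp only [w, mul_smul, sub_smul]
    rw [← smul_sum, sum_sub_distrib, ← smul_sum, hab, inv_smul_eq_iff₀ hr1', sub_smul, one_smul]
  have hm' : m ∈ C.filter (w · ≠ 0) := by
    rwa [h.support_eq hw hb hw1 hb1 ((card_le_card hwsub).trans hbt) hbt hwb]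
  refine (mem_filter.1 hm').2 ?_
  simp [w, hr, div_mul_cancel₀ _ hm0]

theorem stmt_1 (n t : ℕ) (hn : 1 ≤ n) (ht : 2 ≤ t)
    (C : Finset (Fin n → ℝ)) (hbin : IsBinaryCode C)
    (hsig : IsSignatureCode t C) :
    ∀ m₁ m₂ : (Fin n → ℝ) → ℕ,
      (∑ c ∈ C, m₁ c) = t → (∑ c ∈ C, m₂ c) = t →
      (∃ c ∈ C, m₁ c ≠ m₂ c) →
      (∑ c ∈ C, (m₁ c : ℝ) • c) ≠ (∑ c ∈ C, (m₂ c : ℝ) • c) := by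
  intro m₁ m₂ h₁ h₂ ⟨d, hd, hne⟩ hsum
  have ht0 : (t : ℝ) ≠ 0 := by positivity
  have nonneg (m : (Fin n → ℝ) → ℕ) : ∀ c ∈ C, 0 ≤ (t : ℝ)⁻¹ * m c := fun c _ => by positivity
  have sum_one {m : (Fin n → ℝ) → ℕ} (hm : ∑ c ∈ C, m c = t) :
      ∑ c ∈ C, (t : ℝ)⁻¹ * m c = 1 := by
    rw [← mul_sum, ← Nat.cast_sum, hm, inv_mul_cancel₀ ht0]
  have card_le {m : (Fin n → ℝ) → ℕ} (hm : ∑ c ∈ C, m c = t) :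
      (C.filter fun c => (t : ℝ)⁻¹ * m c ≠ 0).card ≤ t := by
    rw [← hm, card_filter]
    refine sum_le_sum fun c _ => ?_
    split_ifs with hc
    · exact Nat.one_le_iff_ne_zero.2 fun h0 => hc (by simp [h0])
    · exact Nat.zero_le _
  have := hsig.eq_of_sum_smul_eq (nonneg m₁) (nonneg m₂) (sum_one h₁) (sum_one h₂)
    (card_le h₁) (card_le h₂) (by simp only [mul_smul, ← smul_sum, hsum]) d hd
  exact hne (Nat.cast_injective (mul_left_cancel₀ (inv_ne_zero ht0) this))
end

section
/- Let n ≥ 1 be an integer and let C be a binary code of length n. Then C is a 2-signature code if and only if for any four pairwise distinct codewords c₁, c₂, c₃, c₄ ∈ C one has c₁ + c₂ ≠ c₃ + c₄ (addition in ℝ^n). -/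
open Finset

/-- A convex combination with positive weights of a nonempty set of at most two vectors is a
proper convex combination of two (possibly equal) vectors exhausting the set. -/
lemma exists_pair_of_card_le_two {E : Type*} [DecidableEq E] [AddCommGroup E] [Module ℝ E]
    {S : Finset E} (h1 : 1 ≤ S.card) (h2 : S.card ≤ 2) {w : E → ℝ}
    (hpos : ∀ c ∈ S, 0 < w c) (hsum : ∑ c ∈ S, w c = 1) :
    ∃ (a b : E) (s : ℝ), S = {a, b} ∧ 0 < s ∧ s < 1 ∧
      ∑ c ∈ S, w c • c = s • a + (1 - s) • b := by
  obtain h | h : S.card = 1 ∨ S.card = 2 := by lia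
  · obtain ⟨a, rfl⟩ := Finset.card_eq_one.mp h
    rw [Finset.sum_singleton] at hsum
    refine ⟨a, a, 1 / 2, by simp, by norm_num, by norm_num, ?_⟩
    rw [Finset.sum_singleton, hsum, ← add_smul]
    norm_num
  · obtain ⟨a, b, hab, rfl⟩ := Finset.card_eq_two.mp h
    rw [Finset.sum_pair hab] at hsum
    have hb : 0 < w b := hpos b (by simp)
    refine ⟨a, b, w a, rfl, hpos a (by simp), by linarith, ?_⟩
    rw [Finset.sum_pair hab, ← hsum, add_sub_cancel_left]

/-- Equal proper convex combinations of two pairs of bits force equal sums. -/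
lemma add_eq_add_of_convexCombination_eq {x y z w s t : ℝ}
    (hx : x = 0 ∨ x = 1) (hy : y = 0 ∨ y = 1) (hz : z = 0 ∨ z = 1) (hw : w = 0 ∨ w = 1)
    (hs0 : 0 < s) (hs1 : s < 1) (ht0 : 0 < t) (ht1 : t < 1)
    (h : s * x + (1 - s) * y = t * z + (1 - t) * w) : x + y = z + w := by
  rcases hx with rfl | rfl <;> rcases hy with rfl | rfl <;> rcases hz with rfl | rfl <;>
    rcases hw with rfl | rfl <;> linarith

/-- A binary vector is the midpoint of two binary vectors only if all three coincide. -/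
lemma eq_and_eq_of_add_self_eq_add {ι : Type*} {a c d : ι → ℝ}
    (ha : ∀ i, a i = 0 ∨ a i = 1) (hc : ∀ i, c i = 0 ∨ c i = 1) (hd : ∀ i, d i = 0 ∨ d i = 1)
    (h : a + a = c + d) : c = a ∧ d = a := by
  have key (i : ι) : c i = a i ∧ d i = a i := by
    have hi := congrFun h i
    simp only [Pi.add_apply] at hi
    rcases ha i with h1 | h1 <;> rcases hc i with h2 | h2 <;> rcases hd i with h3 | h3 <;>
      constructor <;> linarith
  exact ⟨funext fun i => (key i).1, funext fun i => (key i).2⟩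

theorem stmt_2 (n : ℕ) (hn : 1 ≤ n)
    (C : Finset (Fin n → ℝ)) (hbin : IsBinaryCode C) :
    IsSignatureCode 2 C ↔
      ∀ c₁ ∈ C, ∀ c₂ ∈ C, ∀ c₃ ∈ C, ∀ c₄ ∈ C,
        c₁ ≠ c₂ → c₁ ≠ c₃ → c₁ ≠ c₄ → c₂ ≠ c₃ → c₂ ≠ c₄ → c₃ ≠ c₄ →
        c₁ + c₂ ≠ c₃ + c₄ := by
  constructor
  · intro h c₁ h₁ c₂ h₂ c₃ h₃ c₄ h₄ h12 h13 h14 h23 h24 h34 heq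
    refine h {c₁, c₂} (by simp [Finset.insert_subset_iff, h₁, h₂]) {c₃, c₄}
      (by simp [Finset.insert_subset_iff, h₃, h₄]) ?_ (by simp [Finset.card_pair h12])
      (Finset.card_pair h12).le (by simp [Finset.card_pair h34]) (Finset.card_pair h34).le
      (fun _ => 1 / 2) (fun _ => 1 / 2) (fun _ _ => by norm_num) (fun _ _ => by norm_num)
      (by rw [Finset.sum_pair h12]; norm_num) (by rw [Finset.sum_pair h34]; norm_num) ?_
    · intro hset
      have hmem : c₁ ∈ ({c₃, c₄} : Finset (Fin n → ℝ)) := hset ▸ Finset.mem_insert_self _ _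
      simp [h13, h14] at hmem
    · rw [Finset.sum_pair h12, Finset.sum_pair h34, ← smul_add, ← smul_add, heq]
  · intro h C₁ hC₁ C₂ hC₂ hne h1 h1' h2 h2' lam mu hlam hmu hsl hsm heq
    obtain ⟨a, b, s, rfl, hs0, hs1, hs⟩ := exists_pair_of_card_le_two h1 h1' hlam hsl
    obtain ⟨c, d, t, rfl, ht0, ht1, ht⟩ := exists_pair_of_card_le_two h2 h2' hmu hsm
    rw [hs, ht] at heq
    have ha : a ∈ C := hC₁ (by simp)
    have hb : b ∈ C := hC₁ (by simp)
    have hc : c ∈ C := hC₂ (by simp)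
    have hd : d ∈ C := hC₂ (by simp)
    have hadd : a + b = c + d := funext fun i =>
      add_eq_add_of_convexCombination_eq (hbin a ha i) (hbin b hb i) (hbin c hc i) (hbin d hd i)
        hs0 hs1 ht0 ht1 (by simpa using congrFun heq i)
    refine h a ha b hb c hc d hd ?_ ?_ ?_ ?_ ?_ ?_ hadd
    · rintro rfl
      obtain ⟨rfl, rfl⟩ :=
        eq_and_eq_of_add_self_eq_add (hbin a ha) (hbin c hc) (hbin d hd) hadd
      exact hne rfl
    · rintro rfl
      exact hne (by rw [add_left_cancel hadd])
    · rintro rfl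
      rw [add_comm c a] at hadd
      exact hne (by rw [add_left_cancel hadd, Finset.pair_comm])
    · rintro rfl
      rw [add_comm a b] at hadd
      exact hne (by rw [add_left_cancel hadd, Finset.pair_comm])
    · rintro rfl
      exact hne (by rw [add_right_cancel hadd])
    · rintro rfl
      obtain ⟨rfl, rfl⟩ :=
        eq_and_eq_of_add_self_eq_add (hbin c hc) (hbin a ha) (hbin b hb) hadd.symm
      exact hne rfl
end

section
/- Let n ≥ 2 and t ≥ 2 be integers and let C be a t-signature code of length n. If t is even, then |C| ≤ (2t − 3)·(2^{((t+2)n)/(2t+2) + 1} + 2^{(tn)/(2t+2)}); if t is odd, then |C| ≤ (2t − 3)·(2^{((t+1)n)/(2t)} + 2^{⌈n/2⌉} + 2^{⌊n/2⌋}). Here the exponentials are real powers of 2 with real exponents. -/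
open Finset

/-- The alternating coordinate projections along a walk in the bipartite graph of a split code:
`P i` reads off the half of a word that serves as the `i`-th vertex of the walk. -/
structure IsSplitting {n : ℕ} (P : ℕ → (Fin n → ℝ) → Fin n → ℝ) : Prop where
  periodic : ∀ i, P (i + 2) = P i
  add_eq : ∀ i c, P i c + P (i + 1) c = c

/-- The words `c 0, …, c (m - 1)` of `C` are the edges of a non-backtracking walk. -/
structure IsTrail {n : ℕ} (P : ℕ → (Fin n → ℝ) → Fin n → ℝ) (C : Finset (Fin n → ℝ)) (m : ℕ)
    (c : ℕ → Fin n → ℝ) : Prop where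
  mem : ∀ i < m, c i ∈ C
  ne : ∀ i, i + 1 < m → c i ≠ c (i + 1)
  eq : ∀ i, i + 1 < m → P (i + 1) (c i) = P (i + 1) (c (i + 1))

section Splitting

variable {n t : ℕ} {P : ℕ → (Fin n → ℝ) → Fin n → ℝ} {C : Finset (Fin n → ℝ)}

lemma IsSplitting.add_two_mul (hP : IsSplitting P) (i k : ℕ) : P (i + 2 * k) = P i := by
  induction k with
  | zero => rfl
  | succ k ih => rw [show i + 2 * (k + 1) = i + 2 * k + 2 by ring, hP.periodic, ih]

lemma IsSplitting.congr (hP : IsSplitting P) {i j : ℕ} (h : i % 2 = j % 2) : P i = P j := by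
  rw [← Nat.mod_add_div i 2, ← Nat.mod_add_div j 2, hP.add_two_mul, hP.add_two_mul, h]

lemma IsSplitting.shift (hP : IsSplitting P) (s : ℕ) : IsSplitting (fun i => P (s + i)) :=
  ⟨fun i => hP.periodic (s + i), fun i => hP.add_eq (s + i)⟩

lemma IsSplitting.ext (hP : IsSplitting P) (i : ℕ) {c c' : Fin n → ℝ} (h : P i c = P i c')
    (h' : P (i + 1) c = P (i + 1) c') : c = c' := by
  rw [← hP.add_eq i c, ← hP.add_eq i c', h, h']

lemma sum_image_card_smul {k : ℕ} (x : ℕ → Fin n → ℝ) :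
    ∑ c ∈ (range k).image x, ((#{i ∈ range k | x i = c} : ℝ) / k) • c
      = (k : ℝ)⁻¹ • ∑ i ∈ range k, x i := by
  have h := Finset.sum_comp (s := range k) (fun c : Fin n → ℝ => c) x
  rw [h, Finset.smul_sum]
  refine Finset.sum_congr rfl fun c _ => ?_
  rw [← Nat.cast_smul_eq_nsmul ℝ, smul_smul, div_eq_inv_mul]

lemma sum_image_card_div {k : ℕ} (hk : 1 ≤ k) (x : ℕ → Fin n → ℝ) :
    ∑ c ∈ (range k).image x, ((#{i ∈ range k | x i = c} : ℝ) / k) = 1 := by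
  rw [← Finset.sum_div, ← Nat.cast_sum, ← Finset.card_eq_sum_card_image, card_range]
  exact div_self (by positivity)

lemma IsSignatureCode.mono {C' : Finset (Fin n → ℝ)} (hC : IsSignatureCode t C) (h : C' ⊆ C) :
    IsSignatureCode t C' :=
  fun C₁ h₁ C₂ h₂ => hC C₁ (h₁.trans h) C₂ (h₂.trans h)

lemma IsSignatureCode.sum_ne_sum (hC : IsSignatureCode t C) {k : ℕ} (hk : 1 ≤ k) (hkt : k ≤ t)
    {x y : ℕ → Fin n → ℝ} (hx : ∀ i < k, x i ∈ C) (hy : ∀ i < k, y i ∈ C)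
    (hxy : ∀ i < k, ∀ j < k, x i ≠ y j) : ∑ i ∈ range k, x i ≠ ∑ i ∈ range k, y i := by
  have hsub : ∀ z : ℕ → Fin n → ℝ, (∀ i < k, z i ∈ C) → (range k).image z ⊆ C := by
    intro z hz c hc
    obtain ⟨i, hi, rfl⟩ := mem_image.1 hc
    exact hz i (mem_range.1 hi)
  have hpos : ∀ z : ℕ → Fin n → ℝ, ∀ c ∈ (range k).image z,
      0 < (#{i ∈ range k | z i = c} : ℝ) / k := by
    intro z c hc
    obtain ⟨i, hi, rfl⟩ := mem_image.1 hc
    have : 0 < #{j ∈ range k | z j = z i} := card_pos.2 ⟨i, by simpa using hi⟩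
    positivity
  have hone : ∀ z : ℕ → Fin n → ℝ, 1 ≤ #((range k).image z) := fun z =>
    card_pos.2 ⟨z 0, mem_image_of_mem z (mem_range.2 hk)⟩
  have hle : ∀ z : ℕ → Fin n → ℝ, #((range k).image z) ≤ t := fun z =>
    card_image_le.trans (by simpa using hkt)
  have hne : (range k).image x ≠ (range k).image y := by
    intro h
    have h0 : x 0 ∈ (range k).image y := h ▸ mem_image_of_mem x (mem_range.2 hk)
    obtain ⟨j, hj, hj'⟩ := mem_image.1 h0
    exact hxy 0 hk j (mem_range.1 hj) hj'.symm
  intro h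
  refine hC _ (hsub x hx) _ (hsub y hy) hne (hone x) (hle x) (hone y) (hle y) _ _ (hpos x)
    (hpos y) (sum_image_card_div hk x) (sum_image_card_div hk y) ?_
  rw [sum_image_card_smul, sum_image_card_smul, h]

/-- A non-backtracking walk of length at most `2 * t` is not closed. -/
lemma IsTrail.not_closed (hC : IsSignatureCode t C) {k : ℕ} (hk : 1 ≤ k) (hkt : k ≤ t)
    (hP : IsSplitting P) {c : ℕ → Fin n → ℝ} (hc : IsTrail P C (2 * k) c) :
    P 0 (c 0) ≠ P 0 (c (2 * k - 1)) := by
  induction k using Nat.strong_induction_on generalizing P c with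
  | _ k ih =>
  intro hclosed
  have hlt : ∀ i j, i < j → j < 2 * k → i % 2 ≠ j % 2 → c i ≠ c j := by
    intro i j hij hj hpar heq
    rcases (show j = i + 1 ∨ i + 3 ≤ j by omega) with rfl | h3
    · exact hc.ne i hj heq
    obtain ⟨m, hm⟩ : ∃ m, j = i + 1 + 2 * m := ⟨(j - i - 1) / 2, by omega⟩
    have hsub : IsTrail (fun s => P (i + 1 + s)) C (2 * m) (fun s => c (i + 1 + s)) :=
      ⟨fun s hs => hc.mem _ (by omega), fun s hs => hc.ne (i + 1 + s) (by omega),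
        fun s hs => hc.eq (i + 1 + s) (by omega)⟩
    refine ih m (by omega) (by omega) (by omega) (hP.shift (i + 1)) hsub ?_
    have h1 := hc.eq i (by omega)
    have h2 := hc.eq (j - 1) (by omega)
    rw [show j - 1 + 1 = j by omega, hP.congr (show j % 2 = (i + 1) % 2 by omega)] at h2
    simp only [add_zero]
    rw [← h1, show i + 1 + (2 * m - 1) = j - 1 by omega, h2, heq]
  refine hC.sum_ne_sum hk hkt (x := fun i => c (2 * i)) (y := fun i => c (2 * i + 1))
    (fun i hi => hc.mem _ (by omega)) (fun i hi => hc.mem _ (by omega)) ?_ ?_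
  · intro i hi j hj
    rcases lt_or_ge (2 * i) (2 * j + 1) with h | h
    · exact hlt _ _ h (by omega) (by omega)
    · exact (hlt _ _ (by omega) (by omega) (by omega)).symm
  · have hodd : ∑ i ∈ range k, P 1 (c (2 * i)) = ∑ i ∈ range k, P 1 (c (2 * i + 1)) := by
      refine sum_congr rfl fun i hi => ?_
      have := mem_range.1 hi
      have h := hc.eq (2 * i) (by omega)
      rwa [hP.congr (show (2 * i + 1) % 2 = 1 % 2 by omega)] at h
    have heven : ∑ i ∈ range k, P 0 (c (2 * i)) = ∑ i ∈ range k, P 0 (c (2 * i + 1)) := by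
      obtain ⟨l, rfl⟩ : ∃ l, k = l + 1 := ⟨k - 1, by omega⟩
      rw [sum_range_succ', sum_range_succ]
      congr 1
      refine sum_congr rfl fun i hi => ?_
      have := mem_range.1 hi
      have h := hc.eq (2 * i + 1) (by omega)
      rw [hP.congr (show (2 * i + 1 + 1) % 2 = 0 % 2 by omega)] at h
      exact h.symm
    calc ∑ i ∈ range k, c (2 * i)
        = ∑ i ∈ range k, P 0 (c (2 * i)) + ∑ i ∈ range k, P 1 (c (2 * i)) := by
          rw [← sum_add_distrib]
          exact sum_congr rfl fun i _ => (hP.add_eq 0 _).symm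
      _ = ∑ i ∈ range k, c (2 * i + 1) := by
          rw [heven, hodd, ← sum_add_distrib]
          exact sum_congr rfl fun i _ => hP.add_eq 0 _

/-- Non-backtracking walks of length `m ≤ t` with common endpoints have the same last edge. -/
lemma IsTrail.last_eq (hC : IsSignatureCode t C) {m : ℕ} (hm : 1 ≤ m) (hmt : m ≤ t)
    (hP : IsSplitting P) {c f : ℕ → Fin n → ℝ} (hc : IsTrail P C m c) (hf : IsTrail P C m f)
    (h0 : P 0 (c 0) = P 0 (f 0)) (hend : P m (c (m - 1)) = P m (f (m - 1))) :
    c (m - 1) = f (m - 1) := by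
  by_contra hne
  have hz : IsTrail P C (2 * m) (fun i => if i < m then c i else f (2 * m - 1 - i)) := by
    refine ⟨fun i hi => ?_, fun i hi => ?_, fun i hi => ?_⟩
    · split_ifs with h
      · exact hc.mem i h
      · exact hf.mem _ (by omega)
    · rcases lt_trichotomy (i + 1) m with h | h | h
      · simpa [h, show i < m by omega] using hc.ne i h
      · subst h
        simpa [show 2 * (i + 1) - 1 - (i + 1) = i by omega] using hne
      · have := (hf.ne (2 * m - 1 - (i + 1)) (by omega)).symm
        rw [show 2 * m - 1 - (i + 1) + 1 = 2 * m - 1 - i by omega] at this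
        simpa [show ¬ i < m by omega, show ¬ i + 1 < m by omega] using this
    · rcases lt_trichotomy (i + 1) m with h | h | h
      · simpa [h, show i < m by omega] using hc.eq i h
      · subst h
        simpa [show 2 * (i + 1) - 1 - (i + 1) = i by omega] using hend
      · have := (hf.eq (2 * m - 1 - (i + 1)) (by omega)).symm
        rw [show 2 * m - 1 - (i + 1) + 1 = 2 * m - 1 - i by omega,
          hP.congr (show (2 * m - 1 - i) % 2 = (i + 1) % 2 by omega)] at this
        simpa [show ¬ i < m by omega, show ¬ i + 1 < m by omega] using this
  refine hz.not_closed hC hm hmt hP ?_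
  simpa [show 0 < m by omega, show ¬ 2 * m - 1 < m by omega] using h0

open Classical in
/-- The last edges of the non-backtracking walks of length `m` that start at the vertex `u`. -/
noncomputable def lastEdges (P : ℕ → (Fin n → ℝ) → Fin n → ℝ) (C : Finset (Fin n → ℝ))
    (u : Fin n → ℝ) (m : ℕ) : Finset (Fin n → ℝ) :=
  {e ∈ C | ∃ c, IsTrail P C m c ∧ P 0 (c 0) = u ∧ c (m - 1) = e}

lemma lastEdges_subset (u : Fin n → ℝ) (m : ℕ) : lastEdges P C u m ⊆ C := by
  classical
  exact filter_subset _ C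

lemma injOn_lastEdges (hC : IsSignatureCode t C) (hP : IsSplitting P) {u : Fin n → ℝ} {m : ℕ}
    (hm : 1 ≤ m) (hmt : m ≤ t) : Set.InjOn (P m) (lastEdges P C u m) := by
  intro e he f hf hef
  simp only [lastEdges, coe_filter, Set.mem_ofPred_eq] at he hf
  obtain ⟨_, c, hc, hc0, rfl⟩ := he
  obtain ⟨_, g, hg, hg0, rfl⟩ := hf
  exact hc.last_eq hC hm hmt hP hg (hc0.trans hg0.symm) hef

lemma mem_lastEdges_succ {u : Fin n → ℝ} {m : ℕ} (hm : 1 ≤ m) {e e' : Fin n → ℝ}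
    (he : e ∈ lastEdges P C u m) (he' : e' ∈ C) (hne : e' ≠ e) (h : P m e' = P m e) :
    e' ∈ lastEdges P C u (m + 1) := by
  simp only [lastEdges, mem_filter] at he ⊢
  obtain ⟨_, c, hc, hc0, rfl⟩ := he
  refine ⟨he', fun i => if i < m then c i else e', ⟨fun i hi => ?_, fun i hi => ?_,
    fun i hi => ?_⟩, by simpa [show 0 < m by omega] using hc0, by simp⟩
  · split_ifs with hi'
    · exact hc.mem i hi'
    · exact he'
  · rcases (show i + 1 < m ∨ m = i + 1 by omega) with h' | rfl
    · simpa [h', show i < m by omega] using hc.ne i h'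
    · simpa using hne.symm
  · rcases (show i + 1 < m ∨ m = i + 1 by omega) with h' | rfl
    · simpa [h', show i < m by omega] using hc.eq i h'
    · simpa using h.symm

lemma lt_card_lastEdges (hC : IsSignatureCode t C) (hP : IsSplitting P) {d : ℕ → ℝ}
    (hd : ∀ i, 0 < d i) (hdeg : ∀ i, ∀ c ∈ C, d i + 1 < #{c' ∈ C | P i c' = P i c})
    {c₀ : Fin n → ℝ} (hc₀ : c₀ ∈ C) {m : ℕ} (hm : 1 ≤ m) (hmt : m ≤ t) :
    ∏ i ∈ range m, d i < #(lastEdges P C (P 0 c₀) m) := by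
  classical
  induction m, hm using Nat.le_induction with
  | base =>
    have hsub : {c' ∈ C | P 0 c' = P 0 c₀} ⊆ lastEdges P C (P 0 c₀) 1 := by
      intro e he
      simp only [mem_filter, lastEdges] at he ⊢
      exact ⟨he.1, fun _ => e, ⟨fun _ _ => he.1, fun i hi => by omega, fun i hi => by omega⟩,
        he.2, rfl⟩
    have h1 := hdeg 0 c₀ hc₀
    have h2 : (#{c' ∈ C | P 0 c' = P 0 c₀} : ℝ) ≤ #(lastEdges P C (P 0 c₀) 1) := by
      exact_mod_cast card_le_card hsub
    rw [prod_range_one]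
    linarith
  | succ m hm ih =>
    specialize ih (by omega)
    set U := lastEdges P C (P 0 c₀) m
    have hUC : U ⊆ C := lastEdges_subset _ _
    have hdisj : (U : Set (Fin n → ℝ)).PairwiseDisjoint
        (fun e => {c' ∈ C | P m c' = P m e}.erase e) := by
      intro e he f hf hef
      refine disjoint_left.2 fun x hx hx' => hef ?_
      simp only [mem_erase, mem_filter] at hx hx'
      exact injOn_lastEdges hC hP hm (by omega) he hf (hx.2.2.symm.trans hx'.2.2)
    have hsub : U.biUnion (fun e => {c' ∈ C | P m c' = P m e}.erase e)
        ⊆ lastEdges P C (P 0 c₀) (m + 1) := by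
      intro x hx
      obtain ⟨e, he, hx⟩ := mem_biUnion.1 hx
      simp only [mem_erase, mem_filter] at hx
      exact mem_lastEdges_succ hm he hx.2.1 hx.1 hx.2.2
    have hcard := card_le_card hsub
    rw [card_biUnion hdisj] at hcard
    have hfib : ∀ e ∈ U, d m ≤ (#({c' ∈ C | P m c' = P m e}.erase e) : ℝ) := by
      intro e he
      have h1 := hdeg m e (hUC he)
      have h2 : e ∈ ({c' ∈ C | P m c' = P m e} : Finset _) := by simpa using hUC he
      rw [← card_erase_add_one h2] at h1
      push_cast at h1
      linarith
    calc ∏ i ∈ range (m + 1), d i = (∏ i ∈ range m, d i) * d m := prod_range_succ _ _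
      _ < #U * d m := mul_lt_mul_of_pos_right ih (hd m)
      _ = ∑ _e ∈ U, d m := by rw [sum_const, nsmul_eq_mul]
      _ ≤ ∑ e ∈ U, (#({c' ∈ C | P m c' = P m e}.erase e) : ℝ) := sum_le_sum hfib
      _ ≤ #(lastEdges P C (P 0 c₀) (m + 1)) := by exact_mod_cast hcard

/-- Moore bound for the bipartite graph of a split signature code. -/
lemma prod_lt_card_image (hC : IsSignatureCode t C) (ht : 1 ≤ t) (hP : IsSplitting P)
    {d : ℕ → ℝ} (hd : ∀ i, 0 < d i)
    (hdeg : ∀ i, ∀ c ∈ C, d i + 1 < #{c' ∈ C | P i c' = P i c}) (hne : C.Nonempty) :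
    ∏ i ∈ range t, d i < #(C.image (P t)) := by
  obtain ⟨c₀, hc₀⟩ := hne
  refine (lt_card_lastEdges hC hP hd hdeg hc₀ ht le_rfl).trans_le ?_
  rw [← card_image_of_injOn (injOn_lastEdges hC hP ht le_rfl)]
  exact_mod_cast card_le_card (image_subset_image (lastEdges_subset _ _))

end Splitting

section MinDegree

variable {α β : Type*} [DecidableEq β]

lemma card_filter_ne_image (p : α → β) (C : Finset α) {c : α} (hc : c ∈ C) :
    #({x ∈ C | p x ≠ p c}.image p) + 1 ≤ #(C.image p) := by
  have hsub : {x ∈ C | p x ≠ p c}.image p ⊆ (C.image p).erase (p c) := by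
    intro y hy
    simp only [mem_image, mem_filter, mem_erase] at hy ⊢
    obtain ⟨x, ⟨hx, hne⟩, rfl⟩ := hy
    exact ⟨hne, x, hx, rfl⟩
  have := card_le_card hsub
  rw [card_erase_of_mem (mem_image_of_mem p hc)] at this
  have : 0 < #(C.image p) := card_pos.2 ⟨_, mem_image_of_mem p hc⟩
  omega

lemma lt_card_filter_ne {p q : α → β} {v w : ℝ} (hv : 0 ≤ v) (hw : 0 ≤ w) {C : Finset α}
    (h : v * #(C.image p) + w * #(C.image q) < #C) {c : α} (hc : c ∈ C)
    (hcard : (#{x ∈ C | p x = p c} : ℝ) ≤ v) :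
    v * #({x ∈ C | p x ≠ p c}.image p) + w * #({x ∈ C | p x ≠ p c}.image q)
      < #{x ∈ C | p x ≠ p c} := by
  have h1 : (#({x ∈ C | p x ≠ p c}.image p) : ℝ) + 1 ≤ #(C.image p) := by
    exact_mod_cast card_filter_ne_image p C hc
  have h2 : (#({x ∈ C | p x ≠ p c}.image q) : ℝ) ≤ #(C.image q) := by
    exact_mod_cast card_le_card (image_subset_image (filter_subset _ _))
  have h3 : (#{x ∈ C | p x = p c} : ℝ) + #{x ∈ C | p x ≠ p c} = #C := by
    exact_mod_cast card_filter_add_card_filter_not (s := C) (fun x => p x = p c)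
  have h4 := mul_le_mul_of_nonneg_left h1 hv
  have h5 := mul_le_mul_of_nonneg_left h2 hw
  linarith

/-- A bipartite graph with many edges has a subgraph with large minimum degrees. -/
lemma exists_subset_lt_card_fiber (p q : α → β) {v w : ℝ} (hv : 0 ≤ v) (hw : 0 ≤ w)
    (C : Finset α) (h : v * #(C.image p) + w * #(C.image q) < #C) :
    ∃ D ⊆ C, D.Nonempty ∧ (∀ c ∈ D, v < #{x ∈ D | p x = p c}) ∧
      ∀ c ∈ D, w < #{x ∈ D | q x = q c} := by
  induction C using Finset.strongInduction with
  | H C ih =>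
  by_cases h₁ : ∀ c ∈ C, v < #{x ∈ C | p x = p c}
  · by_cases h₂ : ∀ c ∈ C, w < #{x ∈ C | q x = q c}
    · refine ⟨C, Subset.rfl, card_pos.1 ?_, h₁, h₂⟩
      have : (0 : ℝ) < #C := lt_of_le_of_lt (by positivity) h
      exact_mod_cast this
    · push Not at h₂
      obtain ⟨c, hc, hcard⟩ := h₂
      have hss : {x ∈ C | q x ≠ q c} ⊂ C :=
        filter_ssubset.2 ⟨c, hc, by simp⟩
      obtain ⟨D, hD, hD'⟩ := ih _ hss (by
        have := lt_card_filter_ne (q := p) hw hv (by linarith) hc hcard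
        linarith)
      exact ⟨D, hD.trans hss.subset, hD'⟩
  · push Not at h₁
    obtain ⟨c, hc, hcard⟩ := h₁
    have hss : {x ∈ C | p x ≠ p c} ⊂ C := filter_ssubset.2 ⟨c, hc, by simp⟩
    obtain ⟨D, hD, hD'⟩ := ih _ hss (lt_card_filter_ne hv hw h hc hcard)
    exact ⟨D, hD.trans hss.subset, hD'⟩

end MinDegree

section Bounds

variable {n t : ℕ} {P : ℕ → (Fin n → ℝ) → Fin n → ℝ} {C : Finset (Fin n → ℝ)}

lemma exists_subcode_lt_card_fiber (hP : IsSplitting P) {x y N M : ℝ} (hx : 0 < x) (hy : 0 < y)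
    (hN : #(C.image (P 0)) ≤ N) (hM : #(C.image (P 1)) ≤ M)
    (h : (x + 1) * N + (y + 1) * M < #C) :
    ∃ D ⊆ C, D.Nonempty ∧ ∀ i, ∀ c ∈ D,
      (if Even i then x else y) + 1 < #{c' ∈ D | P i c' = P i c} := by
  obtain ⟨D, hDC, hD, h₀, h₁⟩ := exists_subset_lt_card_fiber (P 0) (P 1)
    (v := x + 1) (w := y + 1) (by positivity) (by positivity) C
    (lt_of_le_of_lt (by gcongr) h)
  refine ⟨D, hDC, hD, fun i c hc => ?_⟩
  split_ifs with hi
  · rw [hP.congr (show i % 2 = 0 % 2 by have := Nat.even_iff.1 hi; omega)]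
    exact h₀ c hc
  · rw [hP.congr (show i % 2 = 1 % 2 by have := Nat.not_even_iff.1 hi; omega)]
    exact h₁ c hc

lemma prod_range_two_mul_alternating (x y : ℝ) (s : ℕ) :
    ∏ i ∈ range (2 * s), (if Even i then x else y) = (x * y) ^ s := by
  induction s with
  | zero => simp
  | succ s ih =>
    rw [show 2 * (s + 1) = 2 * s + 1 + 1 by ring, prod_range_succ, prod_range_succ, ih, pow_succ,
      if_pos (even_two_mul s), if_neg (by simp)]
    ring

lemma card_le_of_even (hC : IsSignatureCode t C) (hP : IsSplitting P) (ht : 2 ≤ t) {s : ℕ}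
    (hts : t = 2 * s) {x y N M : ℝ} (hx : 0 < x) (hy : 0 < y)
    (hN : #(C.image (P 0)) ≤ N) (hM : #(C.image (P 1)) ≤ M) (h : N ≤ (x * y) ^ s) :
    #C ≤ (x + 1) * N + (y + 1) * M := by
  by_contra! hlt
  obtain ⟨D, hDC, hD, hdeg⟩ := exists_subcode_lt_card_fiber hP hx hy hN hM hlt
  have hmoore := prod_lt_card_image (hC.mono hDC) (by omega) hP
    (fun i => by split_ifs <;> assumption) hdeg hD
  rw [hts, prod_range_two_mul_alternating, hP.congr (show 2 * s % 2 = 0 % 2 by omega)] at hmoore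
  have : (#(D.image (P 0)) : ℝ) ≤ #(C.image (P 0)) := by
    exact_mod_cast card_le_card (image_subset_image hDC)
  linarith

lemma card_le_of_odd (hC : IsSignatureCode t C) (hP : IsSplitting P) {s : ℕ}
    (hts : t = 2 * s + 1) {x y N M : ℝ} (hx : 0 < x) (hy : 0 < y)
    (hN : #(C.image (P 0)) ≤ N) (hM : #(C.image (P 1)) ≤ M) (h : N * M ≤ (x * y) ^ t) :
    #C ≤ (x + 1) * N + (y + 1) * M := by
  by_contra! hlt
  obtain ⟨D, hDC, hD, hdeg⟩ := exists_subcode_lt_card_fiber hP hx hy hN hM hlt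
  have hmoore₁ := prod_lt_card_image (hC.mono hDC) (by omega) hP
    (fun i => by split_ifs <;> assumption) hdeg hD
  have hmoore₀ := prod_lt_card_image (hC.mono hDC) (by omega) (hP.shift 1)
    (d := fun i => if Even i then y else x)
    (fun i => by split_ifs <;> assumption)
    (fun i c hc => by
      have := hdeg (1 + i) c hc
      simpa only [add_comm 1 i, Nat.even_add_one, ite_not] using this) hD
  rw [hts, prod_range_succ, prod_range_two_mul_alternating, if_pos (even_two_mul s)]
    at hmoore₁ hmoore₀
  rw [hP.congr (show (2 * s + 1) % 2 = 1 % 2 by omega)] at hmoore₁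
  simp only [hP.congr (show (1 + (2 * s + 1)) % 2 = 0 % 2 by omega)] at hmoore₀
  have h₀ : (#(D.image (P 0)) : ℝ) ≤ #(C.image (P 0)) := by
    exact_mod_cast card_le_card (image_subset_image hDC)
  have h₁ : (#(D.image (P 1)) : ℝ) ≤ #(C.image (P 1)) := by
    exact_mod_cast card_le_card (image_subset_image hDC)
  have hprod : ((y * x) ^ s * y) * ((x * y) ^ s * x) < N * M :=
    mul_lt_mul'' (by linarith) (by linarith) (by positivity) (by positivity)
  have : ((y * x) ^ s * y) * ((x * y) ^ s * x) = (x * y) ^ t := by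
    rw [hts, mul_comm y x]
    ring
  linarith

/-- In a `2`-signature code, a pair of words with the same `P 1` part is determined by the pair
of its `P 0` parts. -/
lemma IsSignatureCode.eq_of_rectangle (hC : IsSignatureCode t C) (ht : 2 ≤ t)
    (hP : IsSplitting P) {c c' f f' : Fin n → ℝ} (hc : c ∈ C) (hc' : c' ∈ C) (hf : f ∈ C)
    (hf' : f' ∈ C) (hcc : c ≠ c') (hff : f ≠ f') (h₁ : P 1 c = P 1 c') (h₁' : P 1 f = P 1 f')
    (h₀ : P 0 c = P 0 f) (h₀' : P 0 c' = P 0 f') : c' = f' := by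
  by_contra hne
  have htrail : IsTrail P C (2 * 2)
      (fun i => if i = 0 then c else if i = 1 then c' else if i = 2 then f' else f) := by
    refine ⟨fun i hi => ?_, fun i hi => ?_, fun i hi => ?_⟩
    · interval_cases i <;> simpa
    · have : i < 3 := by omega
      interval_cases i
      · simpa using hcc
      · simpa using hne
      · simpa using hff.symm
    · have : i < 3 := by omega
      interval_cases i
      · simpa using h₁
      · simpa [hP.periodic 0] using h₀'
      · simpa [hP.periodic 1] using h₁'.symm
  exact htrail.not_closed hC (by norm_num) ht hP (by simpa using h₀)

lemma card_sq_le (hC : IsSignatureCode t C) (ht : 2 ≤ t) (hP : IsSplitting P) :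
    #C ^ 2 ≤ #(C.image (P 1)) * (#(C.image (P 0)) ^ 2 + #C) := by
  have hpairs : #{x ∈ C ×ˢ C | P 1 x.1 = P 1 x.2}
      = ∑ v ∈ C.image (P 1), #{c ∈ C | P 1 c = v} ^ 2 := by
    rw [card_eq_sum_card_fiberwise (f := fun x => P 1 x.1) (t := C.image (P 1))]
    · refine sum_congr rfl fun v _ => ?_
      rw [sq, ← card_product]
      congr 1
      ext ⟨c, c'⟩
      simp only [mem_filter, mem_product]
      constructor
      · rintro ⟨⟨⟨h1, h2⟩, h3⟩, h4⟩
        exact ⟨⟨h1, h4⟩, h2, h3 ▸ h4⟩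
      · rintro ⟨⟨h1, h2⟩, h3, h4⟩
        exact ⟨⟨⟨h1, h3⟩, h2.trans h4.symm⟩, h2⟩
    · intro x hx
      simp only [coe_filter, mem_product, Set.mem_ofPred_eq] at hx
      simpa using ⟨x.1, hx.1.1, rfl⟩
  have hdiag : #{x ∈ C ×ˢ C | P 1 x.1 = P 1 x.2}
      ≤ #(C.image (P 0) ×ˢ C.image (P 0)) + #C := by
    have hsplit := card_filter_add_card_filter_not (s := {x ∈ C ×ˢ C | P 1 x.1 = P 1 x.2})
      (fun x => x.1 ≠ x.2)
    rw [← hsplit]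
    gcongr ?_ + ?_
    · refine card_le_card_of_injOn (fun x => (P 0 x.1, P 0 x.2)) ?_ ?_
      · intro x hx
        simp only [coe_filter, mem_filter, mem_product, Set.mem_ofPred_eq] at hx
        simpa using ⟨⟨x.1, hx.1.1.1, rfl⟩, x.2, hx.1.1.2, rfl⟩
      · rintro ⟨c, c'⟩ hx ⟨f, f'⟩ hy hxy
        simp only [coe_filter, mem_filter, mem_product, Set.mem_ofPred_eq, Prod.mk.injEq]
          at hx hy hxy
        have h := hC.eq_of_rectangle ht hP hx.1.1.1 hx.1.1.2 hy.1.1.1 hy.1.1.2 hx.2 hy.2 hx.1.2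
          hy.1.2 hxy.1 hxy.2
        have h' := hP.ext 0 hxy.1 (by rw [zero_add, hx.1.2, hy.1.2, h])
        rw [h, h']
    · refine card_le_card_of_injOn Prod.fst ?_ ?_
      · intro x hx
        simp only [coe_filter, mem_filter, mem_product, Set.mem_ofPred_eq] at hx
        exact hx.1.1.1
      · rintro ⟨c, c'⟩ hx ⟨f, f'⟩ hy hxy
        simp only [coe_filter, mem_filter, Set.mem_ofPred_eq, not_not] at hx hy hxy
        rw [← hx.2, ← hy.2, hxy]
  rw [hpairs, card_product, ← sq] at hdiag
  calc #C ^ 2 = (∑ v ∈ C.image (P 1), #{c ∈ C | P 1 c = v}) ^ 2 := by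
        rw [← card_eq_sum_card_image]
    _ ≤ #(C.image (P 1)) * ∑ v ∈ C.image (P 1), #{c ∈ C | P 1 c = v} ^ 2 :=
        sq_sum_le_card_mul_sum_sq
    _ ≤ _ := Nat.mul_le_mul_left _ hdiag

lemma card_le_of_two (hC : IsSignatureCode t C) (ht : 2 ≤ t) (hP : IsSplitting P) {N r : ℝ}
    (hr : 0 ≤ r) (hN : #(C.image (P 0)) ≤ N) (hM : #(C.image (P 1)) ≤ r ^ 2) :
    #C ≤ r ^ 2 + N * r := by
  have h : (#C : ℝ) ^ 2 ≤ #(C.image (P 1)) * ((#(C.image (P 0)) : ℝ) ^ 2 + #C) := by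
    exact_mod_cast card_sq_le hC ht hP
  have hN0 : 0 ≤ N := (Nat.cast_nonneg _).trans hN
  have h' : (#C : ℝ) ^ 2 ≤ r ^ 2 * (N ^ 2 + #C) := h.trans (by gcongr)
  by_contra! hlt
  have h1 : N * r < #C - r ^ 2 := by linarith
  have h2 : N * r ≤ #C := by nlinarith [sq_nonneg r]
  nlinarith [mul_nonneg hN0 hr]

/-- The splitting of a word into its restrictions to `S` and to the complement of `S`. -/
def restrictSplit (S : Finset (Fin n)) (i : ℕ) (c : Fin n → ℝ) : Fin n → ℝ :=
  fun j => if j ∈ (if Even i then S else Sᶜ) then c j else 0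

lemma isSplitting_restrictSplit (S : Finset (Fin n)) : IsSplitting (restrictSplit S) := by
  refine ⟨fun i => ?_, fun i c => ?_⟩
  · funext c j
    simp [restrictSplit, Nat.even_add]
  · funext j
    by_cases hi : Even i <;> by_cases hj : j ∈ S <;>
      simp [restrictSplit, Nat.even_add_one, hi, hj]

lemma card_image_restrictSplit (hbin : IsBinaryCode C) (S : Finset (Fin n)) (i : ℕ) :
    #(C.image (restrictSplit S i)) ≤ 2 ^ #(if Even i then S else Sᶜ) := by
  have hsub : C.image (restrictSplit S i) ⊆ Fintype.piFinset
      (fun j => if j ∈ (if Even i then S else Sᶜ) then ({0, 1} : Finset ℝ) else {0}) := by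
    intro x hx
    obtain ⟨c, hc, rfl⟩ := mem_image.1 hx
    refine Fintype.mem_piFinset.2 fun j => ?_
    unfold restrictSplit
    generalize (if Even i then S else Sᶜ) = T
    split_ifs with h
    · simpa using hbin c hc j
    · simp
  refine (card_le_card hsub).trans ?_
  generalize (if Even i then S else Sᶜ) = T
  rw [Fintype.card_piFinset]
  simp only [apply_ite card, card_singleton]
  rw [card_pair zero_ne_one]
  simp [prod_ite_mem]

lemma exists_splitting (hbin : IsBinaryCode C) {a : ℕ} (ha : a ≤ n) :
    ∃ P : ℕ → (Fin n → ℝ) → Fin n → ℝ, IsSplitting P ∧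
      (#(C.image (P 0)) : ℝ) ≤ 2 ^ (a : ℝ) ∧ (#(C.image (P 1)) : ℝ) ≤ 2 ^ ((n : ℝ) - a) := by
  obtain ⟨S, -, hS⟩ := exists_subset_card_eq (s := (univ : Finset (Fin n))) (n := a) (by simpa)
  refine ⟨restrictSplit S, isSplitting_restrictSplit S, ?_, ?_⟩
  · have h := card_image_restrictSplit hbin S 0
    rw [if_pos Even.zero, hS] at h
    rw [Real.rpow_natCast]
    exact_mod_cast h
  · have h := card_image_restrictSplit hbin S 1
    rw [if_neg (by simp), card_compl, hS, Fintype.card_fin] at h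
    rw [← Nat.cast_sub ha, Real.rpow_natCast]
    exact_mod_cast h

end Bounds

lemma card_le_of_two_signature {n : ℕ} {C : Finset (Fin n → ℝ)} (hbin : IsBinaryCode C)
    (hsig : IsSignatureCode 2 C) : (#C : ℝ) ≤ 2 * 2 ^ (2 * (n : ℝ) / 3) := by
  have ha : (n : ℝ) ≤ 3 * ((n + 2) / 3 : ℕ) := by
    exact_mod_cast (by omega : n ≤ 3 * ((n + 2) / 3))
  have ha' : 3 * (((n + 2) / 3 : ℕ) : ℝ) ≤ n + 2 := by
    exact_mod_cast (by omega : 3 * ((n + 2) / 3) ≤ n + 2)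
  obtain ⟨P, hP, h₀, h₁⟩ := exists_splitting hbin (show (n + 2) / 3 ≤ n by omega)
  set a : ℝ := (((n + 2) / 3 : ℕ) : ℝ)
  have hcard := card_le_of_two hsig le_rfl hP (r := 2 ^ (((n : ℝ) - a) / 2)) (by positivity) h₀
    (by rw [← Real.rpow_natCast, ← Real.rpow_mul (by norm_num)]; convert h₁ using 2; norm_num)
  set u : ℝ := 2 ^ ((a - n / 3) / 2) with hu
  have hu1 : 1 ≤ u := Real.one_le_rpow (by norm_num) (by linarith)
  have hu2 : u ^ 2 ≤ 2 := by
    rw [hu, ← Real.rpow_natCast, ← Real.rpow_mul (by norm_num)]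
    conv_rhs => rw [← Real.rpow_one 2]
    exact Real.rpow_le_rpow_of_exponent_le (by norm_num) (by push_cast; linarith)
  set r : ℝ := 2 ^ (((n : ℝ) - a) / 2) with hr
  have hr0 : 0 < r := by positivity
  have hX : (2 : ℝ) ^ (2 * (n : ℝ) / 3) = r ^ 2 * u ^ 2 := by
    rw [hr, hu, ← Real.rpow_natCast, ← Real.rpow_natCast, ← Real.rpow_mul (by norm_num),
      ← Real.rpow_mul (by norm_num), ← Real.rpow_add (by norm_num)]
    congr 1
    push_cast
    ring
  have hN : (2 : ℝ) ^ a = r * u ^ 3 := by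
    rw [hr, hu, ← Real.rpow_natCast, ← Real.rpow_mul (by norm_num),
      ← Real.rpow_add (by norm_num)]
    congr 1
    push_cast
    ring
  rw [hX]
  rw [hN] at hcard
  have hkey : 1 + u ^ 3 ≤ 2 * u ^ 2 := by
    have : u ^ 2 - u - 1 ≤ 0 := by linarith
    nlinarith [mul_nonneg (sub_nonneg.2 hu1) (neg_nonneg.2 this)]
  nlinarith [mul_le_mul_of_nonneg_left hkey (sq_nonneg r)]

lemma card_le_of_even_signature {n t : ℕ} (ht : 2 ≤ t) (heven : Even t)
    {C : Finset (Fin n → ℝ)} (hbin : IsBinaryCode C) (hsig : IsSignatureCode t C) :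
    (#C : ℝ) ≤ 4 * 2 ^ ((((t : ℝ) + 2) * n) / (2 * (t : ℝ) + 2)) +
      2 ^ (((t : ℝ) * n) / (2 * (t : ℝ) + 2)) := by
  obtain ⟨s, hs⟩ := heven
  have hts : (t : ℝ) = 2 * s := by rw [hs]; push_cast; ring
  set α : ℝ := ((t : ℝ) * n) / (2 * (t : ℝ) + 2) with hα
  set ξ : ℝ := (((t : ℝ) + 2) * n) / (2 * (t : ℝ) + 2) with hξ
  have hα0 : 0 ≤ α := by positivity
  have hsum : ξ + α = n := by rw [hξ, hα]; field_simp; ring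
  have hξα : (2 * ξ - n) * s = α := by rw [hξ, hα, hts]; field_simp; ring
  have hξ0 : 0 ≤ ξ := by positivity
  have ha : (⌊α⌋₊ : ℝ) ≤ α := Nat.floor_le hα0
  have ha' : α < ⌊α⌋₊ + 1 := Nat.lt_floor_add_one α
  have han : ⌊α⌋₊ ≤ n := by
    have : (⌊α⌋₊ : ℝ) ≤ n := by linarith
    exact_mod_cast this
  obtain ⟨P, hP, h₀, h₁⟩ := exists_splitting hbin han
  set a : ℝ := (⌊α⌋₊ : ℝ)
  have hcard := card_le_of_even hsig hP ht (s := s) (by omega)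
    (x := 2 ^ (ξ - a)) (y := 2 ^ (ξ - (n - a))) (by positivity) (by positivity) h₀ h₁ (by
      rw [← Real.rpow_add (by norm_num), ← Real.rpow_natCast, ← Real.rpow_mul (by norm_num)]
      refine Real.rpow_le_rpow_of_exponent_le (by norm_num) ?_
      rw [show ξ - a + (ξ - (n - a)) = 2 * ξ - n by ring, hξα]
      exact ha)
  rw [add_mul, add_mul, ← Real.rpow_add (by norm_num), ← Real.rpow_add (by norm_num),
    sub_add_cancel, sub_add_cancel] at hcard
  have hN : (2 : ℝ) ^ a ≤ 2 ^ α := Real.rpow_le_rpow_of_exponent_le (by norm_num) ha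
  have hM : (2 : ℝ) ^ ((n : ℝ) - a) ≤ 2 * 2 ^ ξ := by
    rw [mul_comm, ← Real.rpow_add_one (by norm_num)]
    exact Real.rpow_le_rpow_of_exponent_le (by norm_num) (by linarith)
  linarith

lemma card_le_of_odd_signature {n t : ℕ} (hodd : Odd t)
    {C : Finset (Fin n → ℝ)} (hbin : IsBinaryCode C) (hsig : IsSignatureCode t C) :
    (#C : ℝ) ≤ 2 * 2 ^ ((((t : ℝ) + 1) * n) / (2 * (t : ℝ))) +
      2 ^ (((n + 1) / 2 : ℕ) : ℝ) + 2 ^ ((n / 2 : ℕ) : ℝ) := by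
  obtain ⟨s, hs⟩ := hodd
  have ht0 : (t : ℝ) ≠ 0 := by exact_mod_cast (by omega : t ≠ 0)
  set ξ : ℝ := (((t : ℝ) + 1) * n) / (2 * (t : ℝ)) with hξ
  have hξn : (2 * ξ - n) * t = n := by rw [hξ]; field_simp; ring
  obtain ⟨P, hP, h₀, h₁⟩ := exists_splitting hbin (show n / 2 ≤ n by omega)
  have hb : (n : ℝ) - (n / 2 : ℕ) = ((n + 1) / 2 : ℕ) := by
    rw [sub_eq_iff_eq_add]
    exact_mod_cast (by omega : n = (n + 1) / 2 + n / 2)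
  rw [← hb]
  set a : ℝ := ((n / 2 : ℕ) : ℝ)
  have hcard := card_le_of_odd hsig hP hs (x := 2 ^ (ξ - a)) (y := 2 ^ (ξ - (n - a)))
    (by positivity) (by positivity) h₀ h₁ (by
      rw [← Real.rpow_add (by norm_num), ← Real.rpow_add (by norm_num), ← Real.rpow_natCast,
        ← Real.rpow_mul (by norm_num), show ξ - a + (ξ - (n - a)) = 2 * ξ - n by ring, hξn,
        add_sub_cancel])
  rw [add_mul, add_mul, ← Real.rpow_add (by norm_num), ← Real.rpow_add (by norm_num),
    sub_add_cancel, sub_add_cancel] at hcard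
  linarith

theorem stmt_4 (n t : ℕ) (hn : 2 ≤ n) (ht : 2 ≤ t)
    (C : Finset (Fin n → ℝ)) (hbin : IsBinaryCode C)
    (hsig : IsSignatureCode t C) :
    (Even t →
      (C.card : ℝ) ≤ (2 * (t : ℝ) - 3) *
        ((2 : ℝ) ^ ((((t : ℝ) + 2) * n) / (2 * (t : ℝ) + 2) + 1) +
         (2 : ℝ) ^ (((t : ℝ) * n) / (2 * (t : ℝ) + 2)))) ∧
    (Odd t →
      (C.card : ℝ) ≤ (2 * (t : ℝ) - 3) *
        ((2 : ℝ) ^ ((((t : ℝ) + 1) * n) / (2 * (t : ℝ))) +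
         (2 : ℝ) ^ (((n + 1) / 2 : ℕ) : ℝ) +
         (2 : ℝ) ^ ((n / 2 : ℕ) : ℝ))) := by
  have hfactor : ∀ k : ℕ, k ≤ t → (2 * (k : ℝ) - 3) ≤ 2 * (t : ℝ) - 3 := by
    intro k hk
    have : (k : ℝ) ≤ t := by exact_mod_cast hk
    linarith
  refine ⟨fun heven => ?_, fun hodd => ?_⟩
  · rw [Real.rpow_add_one (by norm_num)]
    rcases (show t = 2 ∨ 4 ≤ t by obtain ⟨s, hs⟩ := heven; omega) with rfl | h4
    · refine (card_le_of_two_signature hbin hsig).trans ?_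
      have hexp : (((2 : ℕ) : ℝ) + 2) * n / (2 * ((2 : ℕ) : ℝ) + 2) = 2 * (n : ℝ) / 3 := by
        push_cast
        ring
      rw [hexp]
      have : (0 : ℝ) < 2 ^ (((2 : ℕ) : ℝ) * n / (2 * ((2 : ℕ) : ℝ) + 2)) := by positivity
      push_cast at this ⊢
      linarith
    · refine (card_le_of_even_signature ht heven hbin hsig).trans ?_
      have h5 := hfactor 4 h4
      refine le_trans ?_ (mul_le_mul_of_nonneg_right h5 (by positivity))
      have h1 : (0 : ℝ) < 2 ^ ((((t : ℝ) + 2) * n) / (2 * (t : ℝ) + 2)) := by positivity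
      have h2 : (0 : ℝ) < 2 ^ (((t : ℝ) * n) / (2 * (t : ℝ) + 2)) := by positivity
      push_cast
      linarith
  · refine (card_le_of_odd_signature hodd hbin hsig).trans ?_
    have h3 := hfactor 3 (by obtain ⟨s, hs⟩ := hodd; omega)
    refine le_trans ?_ (mul_le_mul_of_nonneg_right h3 (by positivity))
    have h1 : (0 : ℝ) < 2 ^ ((((t : ℝ) + 1) * n) / (2 * (t : ℝ))) := by positivity
    have h2 : (0 : ℝ) < 2 ^ (((n + 1) / 2 : ℕ) : ℝ) := by positivity
    have h2' : (0 : ℝ) < 2 ^ ((n / 2 : ℕ) : ℝ) := by positivity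
    push_cast at *
    linarith
end

section
/- Let n ≥ 2 be an integer and let C be a 2-signature code of length n. If n ≡ 2 (mod 3), then |C| ≤ 2^{⌊2n/3⌋} + 2^{⌈n/3⌉}·(2^{⌈n/3⌉} − 1)/2; otherwise |C| ≤ 2^{⌈2n/3⌉} + 2^{⌊n/3⌋}·(2^{⌊n/3⌋} − 1)/2. -/
open Finset

lemma le_one_add_choose_two (d : ℕ) : d ≤ 1 + d.choose 2 := by
  cases d with
  | zero => simp
  | succ d => rw [Nat.choose_succ_succ' d 1, Nat.choose_one_right]; omega

/-- A set of edges between `S` and `T` without a four-cycle has at most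
`#T + (#S).choose 2` elements. -/
lemma card_le_card_add_choose_two_of_no_rectangle {α β γ : Type*} [DecidableEq β] [DecidableEq γ]
    (C : Finset α) (S : Finset β) (T : Finset γ) (f : α → β) (g : α → γ)
    (hf : ∀ x ∈ C, f x ∈ S) (hg : ∀ x ∈ C, g x ∈ T)
    (hinj : ∀ x ∈ C, ∀ y ∈ C, f x = f y → g x = g y → x = y)
    (hrect : ∀ x ∈ C, ∀ y ∈ C, ∀ z ∈ C, ∀ w ∈ C, f x ≠ f y → f x = f z → f y = f w →
      g x = g y → g z = g w → g x = g z) :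
    #C ≤ #T + (#S).choose 2 := by
  set F : γ → Finset β := fun s => {x ∈ C | g x = s}.image f with hF
  have hcard (s : γ) : #(F s) = #{x ∈ C | g x = s} := by
    refine card_image_of_injOn fun x hx y hy hxy => ?_
    simp only [coe_filter, Set.mem_ofPred_eq] at hx hy
    exact hinj x hx.1 y hy.1 hxy (hx.2.trans hy.2.symm)
  have hdisj : (T : Set γ).PairwiseDisjoint fun s => powersetCard 2 (F s) := by
    intro s _ s' _ hss
    refine disjoint_left.2 fun u hu hu' => hss ?_
    rw [mem_powersetCard] at hu hu'
    obtain ⟨p, q, hpq, rfl⟩ := card_eq_two.1 hu.2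
    simp only [hF, insert_subset_iff, singleton_subset_iff, mem_image, mem_filter] at hu hu'
    obtain ⟨⟨⟨x, ⟨hx, rfl⟩, rfl⟩, y, ⟨hy, hyx⟩, rfl⟩, -⟩ := hu
    obtain ⟨⟨⟨z, ⟨hz, rfl⟩, hzx⟩, w, ⟨hw, hwz⟩, hwy⟩, -⟩ := hu'
    exact hrect x hx y hy z hz w hw hpq hzx.symm hwy.symm hyx.symm hwz.symm
  have hsub : T.biUnion (fun s => powersetCard 2 (F s)) ⊆ powersetCard 2 S := by
    refine biUnion_subset.2 fun s _ => powersetCard_mono (image_subset_iff.2 fun x hx => ?_)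
    exact hf x (mem_filter.1 hx).1
  calc #C = ∑ s ∈ T, #(F s) := by
        simp only [hcard]
        exact card_eq_sum_card_fiberwise hg
    _ ≤ ∑ s ∈ T, (1 + (#(F s)).choose 2) := sum_le_sum fun s _ => le_one_add_choose_two _
    _ = #T + #(T.biUnion fun s => powersetCard 2 (F s)) := by
        simp [sum_add_distrib, card_biUnion hdisj]
    _ ≤ #T + (#S).choose 2 := by
        rw [← card_powersetCard]
        exact Nat.add_le_add_left (card_le_card hsub) _

lemma IsSignatureCode.eq_or_eq_of_add_eq_add {n : ℕ} {C : Finset (Fin n → ℝ)}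
    (hsig : IsSignatureCode 2 C) {x y z w : Fin n → ℝ} (hx : x ∈ C) (hy : y ∈ C) (hz : z ∈ C)
    (hw : w ∈ C) (hxw : x ≠ w) (hyz : y ≠ z) (h : x + w = y + z) : x = y ∨ x = z := by
  classical
  by_contra! hne
  refine hsig {x, w} (by simp [insert_subset_iff, hx, hw]) {y, z}
    (by simp [insert_subset_iff, hy, hz]) (fun heq => ?_)
    (by simp [card_pair hxw]) (by simp [card_pair hxw]) (by simp [card_pair hyz])
    (by simp [card_pair hyz]) (fun _ => 1 / 2) (fun _ => 1 / 2) (by simp) (by simp) ?_ ?_ ?_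
  · have : x ∈ ({y, z} : Finset (Fin n → ℝ)) := heq ▸ mem_insert_self x _
    simp [hne.1, hne.2] at this
  · rw [sum_pair hxw]; norm_num
  · rw [sum_pair hyz]; norm_num
  · rw [sum_pair hxw, sum_pair hyz, ← smul_add, ← smul_add, h]

lemma IsSignatureCode.card_le {n a b : ℕ} (hn : n = a + b) {C : Finset (Fin n → ℝ)}
    (hbin : IsBinaryCode C) (hsig : IsSignatureCode 2 C) :
    #C ≤ 2 ^ b + 2 ^ a * (2 ^ a - 1) / 2 := by
  classical
  subst hn
  have hmem {c} (hc : c ∈ C) (i) : c i ∈ ({0, 1} : Finset ℝ) := by simpa using hbin c hc i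
  have key := card_le_card_add_choose_two_of_no_rectangle C
    (Fintype.piFinset fun _ : Fin a => ({0, 1} : Finset ℝ))
    (Fintype.piFinset fun _ : Fin b => ({0, 1} : Finset ℝ))
    (fun c i => c (Fin.castAdd b i)) (fun c j => c (Fin.natAdd a j))
    (fun c hc => Fintype.mem_piFinset.2 fun i => hmem hc _)
    (fun c hc => Fintype.mem_piFinset.2 fun i => hmem hc _)
    (fun x _ y _ hf hg => funext <| Fin.addCases (congrFun hf) (congrFun hg)) ?_
  · simpa [Fintype.card_piFinset, card_pair, Nat.choose_two_right] using key
  · intro x hx y hy z hz w hw hxy hxz hyw gxy gzw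
    by_contra hgxz
    have hadd : x + w = y + z := by
      refine funext <| Fin.addCases (fun i => ?_) (fun j => ?_)
      · have h₁ := congrFun hxz i
        have h₂ := congrFun hyw i
        simp only [Pi.add_apply] at h₁ h₂ ⊢
        rw [h₁, h₂, add_comm]
      · have h₁ := congrFun gxy j
        have h₂ := congrFun gzw j
        simp only [Pi.add_apply] at h₁ h₂ ⊢
        rw [h₁, h₂]
    have hxw : x ≠ w := fun h => hxy (by rw [h, hyw])
    have hyz : y ≠ z := fun h => hxy (by rw [h, hxz])
    rcases hsig.eq_or_eq_of_add_eq_add hx hy hz hw hxw hyz hadd with rfl | rfl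
    · exact hxy rfl
    · exact hgxz rfl

theorem stmt_5 (n : ℕ) (hn : 2 ≤ n)
    (C : Finset (Fin n → ℝ)) (hbin : IsBinaryCode C)
    (hsig : IsSignatureCode 2 C) :
    (n % 3 = 2 →
      C.card ≤ 2 ^ (2 * n / 3) + 2 ^ ((n + 2) / 3) * (2 ^ ((n + 2) / 3) - 1) / 2) ∧
    (n % 3 ≠ 2 →
      C.card ≤ 2 ^ ((2 * n + 2) / 3) + 2 ^ (n / 3) * (2 ^ (n / 3) - 1) / 2) := by
  exact ⟨fun h => hsig.card_le (by omega) hbin, fun h => hsig.card_le (by omega) hbin⟩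
end

section
/- A(2,2) = 3, A(3,2) = 5, and A(4,2) = 7; that is, the maximum size of a 2-signature code of length 2 is 3, of length 3 is 5, and of length 4 is 7. -/
open Finset

/-- The set of achievable sizes of `t`-signature codes of length `n`. -/
def sigSizes (n t : ℕ) : Set ℕ :=
  {M | ∃ C : Finset (Fin n → ℝ), IsBinaryCode C ∧ IsSignatureCode t C ∧ C.card = M}

/-- Sums of two distinct elements of `S` determine the pair. -/
def SumDistinct {α : Type*} [Add α] (S : Set α) : Prop :=
  ∀ a ∈ S, ∀ b ∈ S, ∀ c ∈ S, ∀ d ∈ S, a ≠ b → c ≠ d → a + b = c + d → a = c ∨ a = d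

theorem SumDistinct.mono {α : Type*} [Add α] {S T : Set α} (h : SumDistinct T) (hST : S ⊆ T) :
    SumDistinct S :=
  fun a ha b hb c hc d hd ↦ h a (hST ha) b (hST hb) c (hST hc) d (hST hd)

theorem IsSignatureCode.sumDistinct {n : ℕ} {C : Finset (Fin n → ℝ)} (h : IsSignatureCode 2 C) :
    SumDistinct (C : Set (Fin n → ℝ)) := by
  intro a ha b hb c hc d hd hab hcd hsum
  by_contra! hne
  refine h {a, b} (by simp_all [insert_subset_iff]) {c, d} (by simp_all [insert_subset_iff]) ?_
    (by simp [card_pair hab]) (by simp [card_pair hab]) (by simp [card_pair hcd])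
    (by simp [card_pair hcd]) (fun _ ↦ 1 / 2) (fun _ ↦ 1 / 2) (by simp) (by simp) ?_ ?_ ?_
  · intro heq
    have : a ∈ ({c, d} : Finset (Fin n → ℝ)) := heq ▸ mem_insert_self a {b}
    simp_all
  · rw [sum_pair hab]; norm_num
  · rw [sum_pair hcd]; norm_num
  · rw [sum_pair hab, sum_pair hcd, ← smul_add, ← smul_add, hsum]

/-- If a vertex of the cube lies strictly between two vertices, these two coincide. -/
theorem eq_of_binary_convex_combination {n : ℕ} {a c d : Fin n → ℝ}
    (ha : ∀ i, a i = 0 ∨ a i = 1) (hc : ∀ i, c i = 0 ∨ c i = 1) (hd : ∀ i, d i = 0 ∨ d i = 1)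
    {t u : ℝ} (ht : 0 < t) (hu : 0 < u) (htu : t + u = 1) (h : a = t • c + u • d) : c = d := by
  funext i
  have hi := congrFun h i
  simp only [Pi.add_apply, Pi.smul_apply, smul_eq_mul] at hi
  rcases ha i with h1 | h1 <;> rcases hc i with h2 | h2 <;> rcases hd i with h3 | h3 <;>
    rw [h1, h2, h3] at hi <;> rw [h2, h3] <;> linarith

/-- If two open segments between vertices of the cube meet, then they coincide or their midpoints
coincide. -/
theorem pair_eq_or_add_eq_of_binary {n : ℕ} {a b c d : Fin n → ℝ}
    (ha : ∀ i, a i = 0 ∨ a i = 1) (hb : ∀ i, b i = 0 ∨ b i = 1)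
    (hc : ∀ i, c i = 0 ∨ c i = 1) (hd : ∀ i, d i = 0 ∨ d i = 1) (hab : a ≠ b)
    {s r t u : ℝ} (hs : 0 < s) (hr : 0 < r) (ht : 0 < t) (hu : 0 < u)
    (hsr : s + r = 1) (htu : t + u = 1) (h : s • a + r • b = t • c + u • d) :
    (a = c ∧ b = d) ∨ (a = d ∧ b = c) ∨ a + b = c + d := by
  have hi (i : Fin n) : s * a i + r * b i = t * c i + u * d i := by
    simpa only [Pi.add_apply, Pi.smul_apply, smul_eq_mul] using congrFun h i
  have key (i : Fin n) : (a i = b i ∧ c i = a i ∧ d i = a i) ∨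
      (a i = c i ∧ b i = d i ∧ s = t) ∨ (a i = d i ∧ b i = c i ∧ s = u) := by
    have hi := hi i
    rcases ha i with h1 | h1 <;> rcases hb i with h2 | h2 <;> rcases hc i with h3 | h3 <;>
      rcases hd i with h4 | h4 <;> rw [h1, h2, h3, h4] at hi <;> rw [h1, h2, h3, h4] <;>
      norm_num <;> linarith
  obtain ⟨j, hj⟩ := Function.ne_iff.mp hab
  by_cases hst : s = t
  · by_cases hsu : s = u
    · refine Or.inr (Or.inr (funext fun i ↦ ?_))
      simp only [Pi.add_apply]
      rcases key i with h | h | h <;> linarith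
    · refine Or.inl ⟨funext fun i ↦ ?_, funext fun i ↦ ?_⟩ <;>
      · rcases key i with h | h | h
        · linarith
        · linarith
        · exact absurd h.2.2 hsu
  · refine Or.inr (Or.inl ⟨funext fun i ↦ ?_, funext fun i ↦ ?_⟩) <;>
    · rcases key i with h | h | h
      · linarith
      · exact absurd h.2.2 hst
      · linarith

theorem IsBinaryCode.isSignatureCode_two {n : ℕ} {C : Finset (Fin n → ℝ)} (hC : IsBinaryCode C)
    (h : SumDistinct (C : Set (Fin n → ℝ))) : IsSignatureCode 2 C := by
  intro C₁ h₁ C₂ h₂ hne h₁_pos h₁_le h₂_pos h₂_le lam mu hlam hmu hlam_sum hmu_sum heq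
  have hcard₁ : C₁.card = 1 ∨ C₁.card = 2 := by omega
  have hcard₂ : C₂.card = 1 ∨ C₂.card = 2 := by omega
  rcases hcard₁ with hcard₁ | hcard₁ <;> rcases hcard₂ with hcard₂ | hcard₂
  · obtain ⟨a, rfl⟩ := card_eq_one.mp hcard₁
    obtain ⟨c, rfl⟩ := card_eq_one.mp hcard₂
    simp_all
  · obtain ⟨a, rfl⟩ := card_eq_one.mp hcard₁
    obtain ⟨c, d, hcd, rfl⟩ := card_eq_two.mp hcard₂
    rw [sum_pair hcd] at heq hmu_sum
    rw [sum_singleton] at heq hlam_sum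
    rw [hlam_sum, one_smul] at heq
    exact hcd (eq_of_binary_convex_combination (hC a (h₁ (by simp))) (hC c (h₂ (by simp)))
      (hC d (h₂ (by simp))) (hmu c (by simp)) (hmu d (by simp)) hmu_sum heq)
  · obtain ⟨a, b, hab, rfl⟩ := card_eq_two.mp hcard₁
    obtain ⟨c, rfl⟩ := card_eq_one.mp hcard₂
    rw [sum_pair hab] at heq hlam_sum
    rw [sum_singleton] at heq hmu_sum
    rw [hmu_sum, one_smul] at heq
    exact hab (eq_of_binary_convex_combination (hC c (h₂ (by simp))) (hC a (h₁ (by simp)))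
      (hC b (h₁ (by simp))) (hlam a (by simp)) (hlam b (by simp)) hlam_sum heq.symm)
  · obtain ⟨a, b, hab, rfl⟩ := card_eq_two.mp hcard₁
    obtain ⟨c, d, hcd, rfl⟩ := card_eq_two.mp hcard₂
    rw [sum_pair hab] at heq hlam_sum
    rw [sum_pair hcd] at heq hmu_sum
    rcases pair_eq_or_add_eq_of_binary (hC a (h₁ (by simp))) (hC b (h₁ (by simp)))
      (hC c (h₂ (by simp))) (hC d (h₂ (by simp))) hab (hlam a (by simp)) (hlam b (by simp))
      (hmu c (by simp)) (hmu d (by simp)) hlam_sum hmu_sum heq with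
      ⟨rfl, rfl⟩ | ⟨rfl, rfl⟩ | hadd
    · exact hne rfl
    · exact hne (pair_comm a b)
    · rcases h a (h₁ (by simp)) b (h₁ (by simp)) c (h₂ (by simp)) d (h₂ (by simp)) hab hcd hadd
        with rfl | rfl
      · exact hne (by rw [add_left_cancel hadd])
      · rw [add_comm c a] at hadd
        exact hne (by rw [add_left_cancel hadd, pair_comm])

/-- The vectors of a code with natural number coordinates give a signature code as soon as a
finite check succeeds. -/
theorem card_mem_sigSizes_two {n M : ℕ} (D : Finset (Fin n → ℕ)) (hM : D.card = M)
    (hbin : ∀ v ∈ D, ∀ i, v i ≤ 1)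
    (hD : ∀ a ∈ D, ∀ b ∈ D, ∀ c ∈ D, ∀ d ∈ D, a ≠ b → c ≠ d → a + b = c + d → a = c ∨ a = d) :
    M ∈ sigSizes n 2 := by
  let f : (Fin n → ℕ) → Fin n → ℝ := fun v i ↦ v i
  have hf : Function.Injective f := fun v w h ↦ funext fun i ↦ by
    simpa [f] using congrFun h i
  have hbin' : IsBinaryCode (D.image f) := by
    simp only [IsBinaryCode, forall_mem_image]
    intro v hv i
    have := hbin v hv i
    have hvi : v i = 0 ∨ v i = 1 := by omega
    rcases hvi with hvi | hvi <;> simp [f, hvi]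
  refine ⟨D.image f, hbin', hbin'.isSignatureCode_two ?_, (card_image_of_injective D hf).trans hM⟩
  simp only [SumDistinct, coe_image, Set.forall_mem_image]
  intro a ha b hb c hc d hd hab hcd hsum
  have hadd (v w : Fin n → ℕ) : f v + f w = f (v + w) := by funext i; simp [f]
  rw [hadd, hadd] at hsum
  exact (hD a ha b hb c hc d hd (ne_of_apply_ne f hab) (ne_of_apply_ne f hcd) (hf hsum)).imp
    (congrArg f) (congrArg f)

/-- Ternary digits are unique. -/
theorem eq_of_sum_mul_three_pow_eq {n : ℕ} {f g : Fin n → ℕ} (hf : ∀ i, f i ≤ 2)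
    (hg : ∀ i, g i ≤ 2) (h : ∑ i, f i * 3 ^ (i : ℕ) = ∑ i, g i * 3 ^ (i : ℕ)) : f = g := by
  induction n with
  | zero => exact Subsingleton.elim f g
  | succ n ih =>
    simp only [Fin.sum_univ_succ, Fin.val_zero, pow_zero, mul_one, Fin.val_succ, pow_succ,
      ← mul_assoc, ← sum_mul] at h
    have hf₀ := hf 0
    have hg₀ := hg 0
    have htail := ih (f := fun i ↦ f i.succ) (g := fun i ↦ g i.succ) (fun i ↦ hf i.succ)
      (fun i ↦ hg i.succ) (by omega)
    funext i
    refine Fin.cases ?_ (fun j ↦ congrFun htail j) i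
    omega

/-- The natural numbers with `n` ternary digits, all of them 0 or 1. -/
def ternaryCodes : ℕ → List ℕ
  | 0 => [0]
  | n + 1 => (ternaryCodes n).map (3 * ·) ++ (ternaryCodes n).map (3 * · + 1)

theorem sum_mul_three_pow_mem_ternaryCodes {n : ℕ} {f : Fin n → ℕ} (hf : ∀ i, f i ≤ 1) :
    ∑ i, f i * 3 ^ (i : ℕ) ∈ ternaryCodes n := by
  induction n with
  | zero => simp [ternaryCodes]
  | succ n ih =>
    simp only [Fin.sum_univ_succ, Fin.val_zero, pow_zero, mul_one, Fin.val_succ, pow_succ,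
      ← mul_assoc, ← sum_mul]
    have htail := ih (f := fun i ↦ f i.succ) fun i ↦ hf i.succ
    have hf₀ := hf 0
    simp only [ternaryCodes, List.mem_append, List.mem_map]
    rcases Nat.le_one_iff_eq_zero_or_eq_one.mp hf₀ with h | h
    · exact Or.inl ⟨_, htail, by omega⟩
    · exact Or.inr ⟨_, htail, by omega⟩

theorem nodup_ternaryCodes (n : ℕ) : (ternaryCodes n).Nodup := by
  induction n with
  | zero => simp [ternaryCodes]
  | succ n ih =>
    refine List.Nodup.append (ih.map fun a b h ↦ ?_) (ih.map fun a b h ↦ ?_) fun y hy hy' ↦ ?_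
    · simpa using h
    · simpa using h
    · obtain ⟨a, -, rfl⟩ := List.mem_map.mp hy
      obtain ⟨b, -, hb⟩ := List.mem_map.mp hy'
      omega

/-- An upper bound, found by exhaustive search, for the number of elements of a list that can be
added to a set without creating two distinct pairs with the same sum. The bits of `chosen` mark
the elements of the set, those of `sums` the sums of two distinct elements. -/
def maxExtension : List ℕ → ℕ → ℕ → ℕ
  | [], _, _ => 0
  | x :: xs, chosen, sums =>
    cond (Nat.beq (sums &&& (chosen <<< x)) 0)
      (max (maxExtension xs chosen sums)
        (maxExtension xs (chosen ||| (1 <<< x)) (sums ||| (chosen <<< x)) + 1))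
      (maxExtension xs chosen sums)

theorem and_shiftLeft_eq_zero_of_sumDistinct {x chosen sums : ℕ} {A : Set ℕ}
    (h : SumDistinct (insert x A)) (hx : x ∉ A) (hchosen : ∀ a, chosen.testBit a → a ∈ A)
    (hsums : ∀ s, sums.testBit s → ∃ a ∈ A, ∃ b ∈ A, a ≠ b ∧ s = a + b) :
    sums &&& (chosen <<< x) = 0 := by
  refine Nat.eq_of_testBit_eq fun s ↦ ?_
  rw [Nat.zero_testBit, Nat.testBit_and, Nat.testBit_shiftLeft]
  by_contra hs
  simp only [Bool.not_eq_false, Bool.and_eq_true, decide_eq_true_eq] at hs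
  obtain ⟨hs, hxs, ha⟩ := hs
  obtain ⟨b, hb, c, hc, hbc, rfl⟩ := hsums s hs
  have ha := hchosen _ ha
  rcases h x (Or.inl rfl) _ (Or.inr ha) b (Or.inr hb) c (Or.inr hc) (fun h ↦ hx (h ▸ ha)) hbc
    (by omega) with rfl | rfl <;> contradiction

theorem length_le_maxExtension {l xs : List ℕ} (hl : l.Sublist xs) (hnodup : xs.Nodup)
    {chosen sums : ℕ} {A : Set ℕ} (hA : ∀ x ∈ xs, x ∉ A) (h : SumDistinct ({y | y ∈ l} ∪ A))
    (hchosen : ∀ a, chosen.testBit a → a ∈ A)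
    (hsums : ∀ s, sums.testBit s → ∃ a ∈ A, ∃ b ∈ A, a ≠ b ∧ s = a + b) :
    l.length ≤ maxExtension xs chosen sums := by
  induction hl generalizing chosen sums A with
  | slnil => simp
  | @cons l xs x _ ih =>
    have := ih hnodup.of_cons (fun y hy ↦ hA y (List.mem_cons_of_mem x hy)) h hchosen hsums
    rw [maxExtension]
    cases Nat.beq (sums &&& (chosen <<< x)) 0 <;> simp [this]
  | @cons_cons l xs x _ ih =>
    have hx : x ∉ A := hA x List.mem_cons_self
    have hzero : sums &&& (chosen <<< x) = 0 := and_shiftLeft_eq_zero_of_sumDistinct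
      (h.mono (by intro y hy; simp at hy ⊢; tauto)) hx hchosen hsums
    have hle := ih hnodup.of_cons (A := insert x A) (chosen := chosen ||| (1 <<< x))
      (sums := sums ||| (chosen <<< x))
      (fun y hy hyA ↦ hyA.elim (fun hyx ↦ (List.nodup_cons.mp hnodup).1 (hyx ▸ hy))
        (hA y (List.mem_cons_of_mem x hy)))
      (h.mono (by intro y hy; simp at hy ⊢; tauto))
      (fun a ha ↦ by
        rw [Nat.testBit_or, Bool.or_eq_true, Nat.one_shiftLeft, Nat.testBit_two_pow,
          decide_eq_true_eq] at ha
        exact ha.elim (fun ha ↦ Or.inr (hchosen a ha)) fun ha ↦ Or.inl ha.symm)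
      (fun s hs ↦ by
        rw [Nat.testBit_or, Bool.or_eq_true, Nat.testBit_shiftLeft, Bool.and_eq_true,
          decide_eq_true_eq] at hs
        rcases hs with hs | ⟨hxs, hs⟩
        · obtain ⟨a, ha, b, hb, hab, rfl⟩ := hsums s hs
          exact ⟨a, Or.inr ha, b, Or.inr hb, hab, rfl⟩
        · have ha := hchosen _ hs
          exact ⟨x, Or.inl rfl, _, Or.inr ha, fun h ↦ hx (h ▸ ha), by omega⟩)
    simp [maxExtension, hzero, hle]

theorem card_le_maxExtension {n : ℕ} {C : Finset (Fin n → ℝ)} (hC : IsBinaryCode C)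
    (h : SumDistinct (C : Set (Fin n → ℝ))) : C.card ≤ maxExtension (ternaryCodes n) 0 0 := by
  choose! g hg using fun c (hc : c ∈ C) (i : Fin n) ↦
    show ∃ k : ℕ, k ≤ 1 ∧ (k : ℝ) = c i by
      rcases hC c hc i with h | h
      · exact ⟨0, by simp [h]⟩
      · exact ⟨1, by simp [h]⟩
  let e : (Fin n → ℝ) → ℕ := fun c ↦ ∑ i, g c i * 3 ^ (i : ℕ)
  have hadd : ∀ a ∈ C, ∀ b ∈ C, ∀ c ∈ C, ∀ d ∈ C, e a + e b = e c + e d → a + b = c + d := by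
    intro a ha b hb c hc d hd hsum
    have hfun := eq_of_sum_mul_three_pow_eq (f := fun i ↦ g a i + g b i)
      (g := fun i ↦ g c i + g d i)
      (fun i ↦ by have := (hg a ha i).1; have := (hg b hb i).1; omega)
      (fun i ↦ by have := (hg c hc i).1; have := (hg d hd i).1; omega)
      (by simpa only [add_mul, sum_add_distrib] using hsum)
    funext i
    simp only [Pi.add_apply, ← (hg a ha i).2, ← (hg b hb i).2, ← (hg c hc i).2, ← (hg d hd i).2]
    exact_mod_cast congrFun hfun i
  have hinj : Set.InjOn e C := fun a ha b hb hab ↦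
    add_right_cancel (hadd a ha a ha b hb a ha (by rw [hab]))
  let l := (ternaryCodes n).filter (· ∈ C.image e)
  have hsub : C.image e ⊆ l.toFinset := by
    intro y hy
    simp only [l, List.mem_toFinset, List.mem_filter, decide_eq_true_eq]
    refine ⟨?_, hy⟩
    obtain ⟨c, hc, rfl⟩ := mem_image.mp hy
    exact sum_mul_three_pow_mem_ternaryCodes fun i ↦ (hg c hc i).1
  have himage : SumDistinct (e '' (C : Set (Fin n → ℝ))) := by
    simp only [SumDistinct, Set.forall_mem_image]
    intro a ha b hb c hc d hd hab hcd hsum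
    exact (h a ha b hb c hc d hd (ne_of_apply_ne e hab) (ne_of_apply_ne e hcd)
      (hadd a ha b hb c hc d hd hsum)).imp (congrArg e) (congrArg e)
  calc C.card = (C.image e).card := (card_image_of_injOn hinj).symm
    _ ≤ l.toFinset.card := card_le_card hsub
    _ ≤ l.length := l.toFinset_card_le
    _ ≤ _ := length_le_maxExtension (A := ∅) List.filter_sublist (nodup_ternaryCodes n) (by simp)
      (himage.mono fun y hy ↦ by simpa [l] using (List.mem_filter.mp (hy.resolve_right id)).2)
      (by simp) (by simp)

theorem le_maxExtension_of_mem_sigSizes {n M : ℕ} (h : M ∈ sigSizes n 2) :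
    M ≤ maxExtension (ternaryCodes n) 0 0 := by
  obtain ⟨C, hC, hsig, rfl⟩ := h
  exact card_le_maxExtension hC hsig.sumDistinct

theorem stmt_6 :
    IsGreatest (sigSizes 2 2) 3 ∧ IsGreatest (sigSizes 3 2) 5 ∧
      IsGreatest (sigSizes 4 2) 7 := by
  refine ⟨⟨?_, fun M hM ↦ (le_maxExtension_of_mem_sigSizes hM).trans (by decide +kernel)⟩,
    ⟨?_, fun M hM ↦ (le_maxExtension_of_mem_sigSizes hM).trans (by decide +kernel)⟩,
    ⟨?_, fun M hM ↦ (le_maxExtension_of_mem_sigSizes hM).trans (by decide +kernel)⟩⟩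
  · exact card_mem_sigSizes_two {![0, 0], ![0, 1], ![1, 0]} (by decide +kernel)
      (by decide +kernel) (by decide +kernel)
  · exact card_mem_sigSizes_two
      {![0, 0, 0], ![0, 0, 1], ![0, 1, 0], ![1, 0, 0], ![1, 1, 1]} (by decide +kernel)
      (by decide +kernel) (by decide +kernel)
  · exact card_mem_sigSizes_two
      {![0, 0, 0, 0], ![0, 0, 0, 1], ![0, 0, 1, 0], ![0, 1, 0, 0], ![0, 1, 1, 1], ![1, 0, 0, 1],
        ![1, 1, 1, 0]} (by decide +kernel)
      (by decide +kernel) (by decide +kernel)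
end
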